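/- The number of projective F_27-rational points on the plane curve x¹³ = y¹³ + y⁹z⁴ + y³z¹⁰ + yz¹² + 2z¹³ is 280. -/

import Mathlib

section NormForm

/-- The norm of `i + j a + k a²`, where `a ^ 3 = a + 1`, as a cubic form over the prime field. -/
def normForm {R : Type*} [CommRing R] (i j k : R) : R :=
  i ^ 3 + j ^ 3 + k ^ 3 + 2 * i ^ 2 * k - i * j ^ 2 + i * k ^ 2 - j * k ^ 2

variable {K : Type*} [Field K]

/-- In a field with 27 elements the polynomial `X ^ 3 - X - 1` has a root. -/
theorem exists_cube_eq_add_one [CharP K 3] (hK : Nat.card K = 27) : ∃ a : K, a ^ 3 = a + 1 := by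
  have : Finite K := Nat.finite_of_card_ne_zero (by omega)
  have := Fintype.ofFinite K
  have h3 : (3 : K) = 0 := by exact_mod_cast CharP.cast_eq_zero K 3
  by_contra! h
  let t : Polynomial K := Polynomial.X ^ 3 - Polynomial.X - 1
  have ht : t.natDegree = 3 := by unfold t; compute_degree!
  let q : Polynomial K := t ^ 8 + t ^ 2 + 1
  have hq0 : q ≠ 0 := by
    intro h0
    have h4 : (Polynomial.X ^ 8 + Polynomial.X ^ 2 + 1 : Polynomial K).comp t = q := by
      simp [q]
    have h5 : (Polynomial.X ^ 8 + Polynomial.X ^ 2 + 1 : Polynomial K).natDegree = 8 := by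
      compute_degree!
    have h6 := Polynomial.natDegree_comp (p := (Polynomial.X ^ 8 + Polynomial.X ^ 2 + 1)) (q := t)
    rw [h4, h5, ht, h0] at h6
    simp at h6
  have hqd : q.natDegree ≤ 24 := by
    unfold q
    compute_degree
    rw [ht]
  have hroot (y : K) : q.eval y = 0 := by
    have hy : y ^ 27 = y := by
      have := FiniteField.pow_card y
      rwa [← Nat.card_eq_fintype_card, hK] at this
    have hne : y ^ 3 - y - 1 ≠ 0 := fun h0 => h y (by linear_combination h0)
    have cube (u v : K) : (u - v) ^ 3 = u ^ 3 - v ^ 3 := by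
      linear_combination (u * v ^ 2 - u ^ 2 * v) * h3
    have hs : (y ^ 3 - y - 1) ^ 3 = y ^ 9 - y ^ 3 - 1 := by rw [cube, cube]; ring
    have hs9 : (y ^ 3 - y - 1) ^ 9 = y ^ 27 - y ^ 9 - 1 := by
      rw [show (9 : ℕ) = 3 * 3 from rfl, pow_mul, hs, cube, cube]; ring
    have : (y ^ 3 - y - 1) * q.eval y = 0 := by
      simp only [q, t, Polynomial.eval_add, Polynomial.eval_pow, Polynomial.eval_sub,
        Polynomial.eval_X, Polynomial.eval_one]
      linear_combination hs9 + hs + hy - h3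
    exact (mul_eq_zero.mp this).resolve_left hne
  have hle : Fintype.card K ≤ q.natDegree := by
    classical
    rw [← Finset.card_univ]
    refine Polynomial.card_le_degree_of_subset_roots fun y _ => ?_
    exact (Polynomial.mem_roots hq0).2 (hroot y)
  rw [← Nat.card_eq_fintype_card, hK] at hle
  omega

/-- The Frobenius conjugates of `i + j a + k a²`. -/
theorem conjugates_eq {a i j k : K} (h3 : (3 : K) = 0) (ha : a ^ 3 = a + 1)
    (hi : i ^ 3 = i) (hj : j ^ 3 = j) (hk : k ^ 3 = k) :
    (i + j * a + k * a ^ 2) ^ 3 = i + j * (a + 1) + k * (a + 1) ^ 2 ∧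
      (i + j * a + k * a ^ 2) ^ 9 = i + j * (a + 1 + 1) + k * (a + 1 + 1) ^ 2 := by
  have cube (u v w : K) : (u + v + w) ^ 3 = u ^ 3 + v ^ 3 + w ^ 3 := by
    linear_combination
      (u ^ 2 * v + u ^ 2 * w + v ^ 2 * u + v ^ 2 * w + w ^ 2 * u + w ^ 2 * v + 2 * u * v * w) * h3
  have h1 (b : K) (hb : b ^ 3 = b + 1) :
      (i + j * b + k * b ^ 2) ^ 3 = i + j * (b + 1) + k * (b + 1) ^ 2 := by
    rw [cube, mul_pow, mul_pow, hi, hj, hk, ← pow_mul, mul_comm 2 3, pow_mul, hb]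
  have ha' : (a + 1) ^ 3 = a + 1 + 1 := by linear_combination ha + (a ^ 2 + a) * h3
  refine ⟨h1 a ha, ?_⟩
  rw [show (9 : ℕ) = 3 * 3 from rfl, pow_mul, h1 a ha, h1 _ ha']

theorem pow_thirteen_eq_normForm {a i j k : K} (h3 : (3 : K) = 0) (ha : a ^ 3 = a + 1)
    (hi : i ^ 3 = i) (hj : j ^ 3 = j) (hk : k ^ 3 = k) :
    (i + j * a + k * a ^ 2) ^ 13 = normForm i j k := by
  obtain ⟨h1, h9⟩ := conjugates_eq h3 ha hi hj hk
  rw [show (13 : ℕ) = 1 + 3 + 9 from rfl, pow_add, pow_add, h9, h1, pow_one, normForm]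
  linear_combination
    (a ^ 3 * k ^ 3 + 3 * a ^ 2 * j * k ^ 2 + 6 * a ^ 2 * k ^ 3 + 3 * a * i * k ^ 2 + 3 * a
      * j ^ 2 * k + 15 * a * j * k ^ 2 + 14 * a * k ^ 3 + 6 * i * j * k + 12 * i * k ^ 2 +
      j ^ 3 + 12 * j ^ 2 * k + 29 * j * k ^ 2 + 19 * k ^ 3) * ha
    + (a * i ^ 2 * j + i ^ 2 * j + a ^ 2 * i ^ 2 * k + 2 * a * i ^ 2 * k + i ^ 2 * k + a ^ 2
      * i * j ^ 2 + 2 * a * i * j ^ 2 + 6 * a ^ 2 * i * j * k + 8 * a * i * j * k + i * j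
      ^ 2 + 4 * i * j * k + 7 * a ^ 2 * i * k ^ 2 + 9 * a * i * k ^ 2 + 5 * i * k ^ 2 + a
      ^ 2 * j ^ 3 + 6 * a ^ 2 * j ^ 2 * k + a * j ^ 3 + 7 * a * j ^ 2 * k + 12 * a ^ 2 * j
      * k ^ 2 + 16 * a * j * k ^ 2 + 8 * a ^ 2 * k ^ 3 + 11 * a * k ^ 3 + 4 * j ^ 2 * k +
      10 * j * k ^ 2 + 6 * k ^ 3) * h3

theorem trace_eq {a i j k : K} (h3 : (3 : K) = 0) (ha : a ^ 3 = a + 1)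
    (hi : i ^ 3 = i) (hj : j ^ 3 = j) (hk : k ^ 3 = k) :
    (i + j * a + k * a ^ 2) ^ 9 + (i + j * a + k * a ^ 2) ^ 3 + (i + j * a + k * a ^ 2)
      = 2 * k := by
  obtain ⟨h1, h9⟩ := conjugates_eq h3 ha hi hj hk
  rw [h9, h1]
  linear_combination (i + j * (a + 1) + k * (a ^ 2 + 2 * a + 1)) * h3

/-- A field with 27 elements has a basis `1, a, a²` over the prime field with `a ^ 3 = a + 1`; in
its coordinates `x ^ 13` is the norm form, and the trace is twice the last coordinate. -/
theorem exists_equiv_coordinates [Algebra (ZMod 3) K] (hK : Nat.card K = 27) :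
    ∃ e : ZMod 3 × ZMod 3 × ZMod 3 ≃ K,
      (∀ v, e v ^ 13 = algebraMap (ZMod 3) K (normForm v.1 v.2.1 v.2.2)) ∧
      ∀ v, e v ^ 9 + e v ^ 3 + e v = algebraMap (ZMod 3) K (2 * v.2.2) := by
  have : CharP K 3 := charP_of_injective_algebraMap (algebraMap (ZMod 3) K).injective 3
  have : Finite K := Nat.finite_of_card_ne_zero (by omega)
  have h3 : (3 : K) = 0 := by exact_mod_cast CharP.cast_eq_zero K 3
  have h2 : algebraMap (ZMod 3) K 2 = 2 := map_ofNat _ 2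
  obtain ⟨a, ha⟩ := exists_cube_eq_add_one hK
  have hc (c : ZMod 3) : algebraMap (ZMod 3) K c ^ 3 = algebraMap (ZMod 3) K c := by
    rw [← map_pow, ZMod.pow_card]
  let φ : ZMod 3 × ZMod 3 × ZMod 3 →+ K :=
    { toFun v := algebraMap (ZMod 3) K v.1 + algebraMap (ZMod 3) K v.2.1 * a
        + algebraMap (ZMod 3) K v.2.2 * a ^ 2
      map_zero' := by simp
      map_add' u v := by simp only [Prod.fst_add, Prod.snd_add, map_add]; ring }
  have hnorm (v) : φ v ^ 13 = algebraMap (ZMod 3) K (normForm v.1 v.2.1 v.2.2) := by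
    refine (pow_thirteen_eq_normForm h3 ha (hc _) (hc _) (hc _)).trans ?_
    simp only [normForm, map_add, map_sub, map_mul, map_pow, h2]
  have hinj : Function.Injective φ := by
    refine (injective_iff_map_eq_zero φ).2 fun v hv => ?_
    have h0 : normForm v.1 v.2.1 v.2.2 = 0 := by
      apply (algebraMap (ZMod 3) K).injective
      rw [← hnorm, hv]
      simp
    have h : ∀ v : ZMod 3 × ZMod 3 × ZMod 3, normForm v.1 v.2.1 v.2.2 = 0 → v = 0 := by
      unfold normForm
      decide
    exact h v h0
  have hbij : Function.Bijective φ :=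
    (Nat.bijective_iff_injective_and_card φ).2 ⟨hinj, by simp [hK]⟩
  refine ⟨Equiv.ofBijective φ hbij, hnorm, fun v => ?_⟩
  refine (trace_eq h3 ha (hc _) (hc _) (hc _)).trans ?_
  rw [map_mul, h2]

end NormForm

section Count

variable {K : Type*} [Field K]

theorem card_pow_thirteen_eq_one [Algebra (ZMod 3) K] (hK : Nat.card K = 27) :
    Nat.card {x : K // x ^ 13 = 1} = 13 := by
  obtain ⟨e, hnorm, -⟩ := exists_equiv_coordinates hK
  have h (v) : normForm v.1 v.2.1 v.2.2 = (1 : ZMod 3) ↔ e v ^ 13 = 1 := by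
    rw [hnorm, ← (algebraMap (ZMod 3) K).injective.eq_iff, map_one]
  rw [← Nat.card_congr (e.subtypeEquiv h), Nat.card_eq_fintype_card]
  unfold normForm
  decide

theorem card_affine_points [Algebra (ZMod 3) K] (hK : Nat.card K = 27) :
    Nat.card {p : K × K // p.1 ^ 13 = p.2 ^ 13 + p.2 ^ 9 + p.2 ^ 3 + p.2 + 2} = 267 := by
  obtain ⟨e, hnorm, htrace⟩ := exists_equiv_coordinates hK
  have h (v : (ZMod 3 × ZMod 3 × ZMod 3) × (ZMod 3 × ZMod 3 × ZMod 3)) :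
      normForm v.1.1 v.1.2.1 v.1.2.2 = normForm v.2.1 v.2.2.1 v.2.2.2 + 2 * v.2.2.2 + 2 ↔
      (e.prodCongr e v).1 ^ 13 = (e.prodCongr e v).2 ^ 13 + (e.prodCongr e v).2 ^ 9
        + (e.prodCongr e v).2 ^ 3 + (e.prodCongr e v).2 + 2 := by
    rw [← (algebraMap (ZMod 3) K).injective.eq_iff]
    simp only [map_add, ← hnorm, ← htrace, map_ofNat, Equiv.prodCongr_apply, Prod.map,
      add_assoc]
  rw [← Nat.card_congr ((e.prodCongr e).subtypeEquiv h), Nat.card_eq_fintype_card]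
  unfold normForm
  decide +kernel

variable (F : K → K → K → Prop)

/-- Points of the projective plane satisfying a scale-invariant condition that `[1 : 0 : 0]` fails
are affine points `[x : y : 1]` or points at infinity `[x : 1 : 0]`. -/
theorem card_plane_points [Finite K]
    (hF : ∀ c x y z : K, c ≠ 0 → (F (c * x) (c * y) (c * z) ↔ F x y z)) (h100 : ¬ F 1 0 0) :
    Nat.card {P : Projectivization K (Fin 3 → K) // F (P.rep 0) (P.rep 1) (P.rep 2)}
      = Nat.card {p : K × K // F p.1 p.2 1} + Nat.card {x : K // F x 1 0} := by
  have hrep (v : Fin 3 → K) (hv : v ≠ 0) :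
      F ((Projectivization.mk K v hv).rep 0) ((Projectivization.mk K v hv).rep 1)
        ((Projectivization.mk K v hv).rep 2) ↔ F (v 0) (v 1) (v 2) := by
    obtain ⟨c, hc⟩ := Projectivization.exists_smul_eq_mk_rep K v hv
    rw [← hc]
    exact hF c _ _ _ c.ne_zero
  have hne (x y : K) : ![x, y, 1] ≠ 0 := fun h => by simpa using congrFun h 2
  have hne' (x : K) : ![x, 1, 0] ≠ 0 := fun h => by simpa using congrFun h 1
  let g : {p : K × K // F p.1 p.2 1} ⊕ {x : K // F x 1 0} →
      {P : Projectivization K (Fin 3 → K) // F (P.rep 0) (P.rep 1) (P.rep 2)} :=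
    Sum.elim (fun p => ⟨.mk K ![p.1.1, p.1.2, 1] (hne _ _), (hrep _ _).2 p.2⟩)
      (fun x => ⟨.mk K ![x.1, 1, 0] (hne' _), (hrep _ _).2 x.2⟩)
  have hg : Function.Bijective g := by
    constructor
    · rintro (⟨⟨x, y⟩, h⟩ | ⟨x, h⟩) (⟨⟨x', y'⟩, h'⟩ | ⟨x', h'⟩) heq <;>
        obtain ⟨c, hc⟩ := (Projectivization.mk_eq_mk_iff' K _ _ _ _).1 (congrArg Subtype.val heq) <;>
        have h0 := congrFun hc 0 <;> have h1 := congrFun hc 1 <;> have h2 := congrFun hc 2 <;>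
        simp at h0 h1 h2 <;> grind
    · rintro ⟨P, hP⟩
      induction P using Projectivization.ind with | h v hv =>
      rw [hrep] at hP
      by_cases hz : v 2 = 0
      · by_cases hy : v 1 = 0
        · have hx : v 0 ≠ 0 := fun hx => hv (by ext i; fin_cases i <;> assumption)
          refine absurd ((hF (v 0) 1 0 0 hx).1 ?_) h100
          simpa [hz, hy] using hP
        · refine ⟨.inr ⟨(v 1)⁻¹ * v 0, ?_⟩, Subtype.ext ?_⟩
          · rw [← hF (v 1) _ _ _ hy]
            simpa [hy, hz] using hP
          · refine (Projectivization.mk_eq_mk_iff' K _ _ _ _).2 ⟨(v 1)⁻¹, ?_⟩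
            ext i; fin_cases i <;> simp [hy, hz]
      · refine ⟨.inl ⟨((v 2)⁻¹ * v 0, (v 2)⁻¹ * v 1), ?_⟩, Subtype.ext ?_⟩
        · rw [← hF (v 2) _ _ _ hz]
          simpa [hz] using hP
        · refine (Projectivization.mk_eq_mk_iff' K _ _ _ _).2 ⟨(v 2)⁻¹, ?_⟩
          ext i; fin_cases i <;> simp [hz]
  rw [← Nat.card_congr (Equiv.ofBijective g hg), Nat.card_sum]

end Count

theorem stmt16 :
    Nat.card {P : Projectivization (GaloisField 3 3) (Fin 3 → GaloisField 3 3) //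
      (P.rep 0) ^ 13 = (P.rep 1) ^ 13 + (P.rep 1) ^ 9 * (P.rep 2) ^ 4
        + (P.rep 1) ^ 3 * (P.rep 2) ^ 10 + (P.rep 1) * (P.rep 2) ^ 12
        + 2 * (P.rep 2) ^ 13} = 280 := by
  have hK : Nat.card (GaloisField 3 3) = 27 := GaloisField.card 3 3 (by norm_num)
  have hcard := card_plane_points (fun x y z : GaloisField 3 3 =>
    x ^ 13 = y ^ 13 + y ^ 9 * z ^ 4 + y ^ 3 * z ^ 10 + y * z ^ 12 + 2 * z ^ 13)
    (fun c x y z hc => by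
      rw [← mul_right_inj' (pow_ne_zero 13 hc) (b := x ^ 13)]
      ring_nf) (by simp)
  refine hcard.trans ?_
  have h1 := card_affine_points hK
  have h2 := card_pow_thirteen_eq_one hK
  simp only [one_pow, mul_one, ne_eq, OfNat.ofNat_ne_zero, not_false_eq_true, zero_pow, mul_zero,
    add_zero]
  rw [h1, h2]
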